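/- Generalized Landauer bound: if A and B are uniform eidostates with A → B, then Δ⟨𝕊⟩ ≥ −ΔH, i.e., ⟨𝕊⟩_B − ⟨𝕊⟩_A ≥ −(H_B − H_A), where for a uniform eidostate E, ⟨𝕊⟩_E = Σ_{a ∈ E} P(a|E)·𝕊(a) is the mean state entropy and H_E = −Σ_{a ∈ E} P(a|E)·log₂ P(a|E) is the Shannon entropy of the entropic probability distribution P(a|E) = 2^{𝕊(a) − 𝕊(E)}. -/

import Mathlib

structure EidoSys where
  State : Type
  [decEq : DecidableEq State]
  Eido : Set (Finset State)
  pair : State → State → State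
  Sim : Finset State → Finset State → Prop
  Arrow : Finset State → Finset State → Prop
  pair_inj : ∀ a b a' b', pair a b = pair a' b' → a = a' ∧ b = b'
  eido_nonempty : ∀ A ∈ Eido, A.Nonempty
  singleton_mem : ∀ a : State, ({a} : Finset State) ∈ Eido
  comb_mem : ∀ A B : Finset State, Finset.image₂ pair A B ∈ Eido ↔ A ∈ Eido ∧ B ∈ Eido
  subset_mem : ∀ A B : Finset State, A ∈ Eido → B ⊆ A → B.Nonempty → B ∈ Eido
  sim_refl : ∀ A : Finset State, Sim A A
  sim_symm : ∀ A B : Finset State, Sim A B → Sim B A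
  sim_trans : ∀ A B C : Finset State, Sim A B → Sim B C → Sim A C
  sim_comm : ∀ A B : Finset State, Sim (Finset.image₂ pair A B) (Finset.image₂ pair B A)
  sim_assoc : ∀ A B C : Finset State,
    Sim (Finset.image₂ pair (Finset.image₂ pair A B) C) (Finset.image₂ pair A (Finset.image₂ pair B C))
  sim_congr : ∀ A B C : Finset State, Sim A B → Sim (Finset.image₂ pair A C) (Finset.image₂ pair B C)
  arrow_of_sim : ∀ A B : Finset State, A ∈ Eido → B ∈ Eido → Sim A B → Arrow A B
  arrow_trans : ∀ A B C : Finset State, Arrow A B → Arrow B C → Arrow A C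
  arrow_comb : ∀ A B C : Finset State, Arrow A B → Arrow (Finset.image₂ pair A C) (Finset.image₂ pair B C)
  arrow_cancel : ∀ (A B : Finset State) (s : State),
    Arrow (Finset.image₂ pair A {s}) (Finset.image₂ pair B {s}) → Arrow A B
  arrow_nsubset : ∀ A B : Finset State, A ∈ Eido → B ∈ Eido → B ⊂ A → ¬ Arrow A B
  arrow_subset_single : ∀ (A A' : Finset State) (b : State),
    A ∈ Eido → A' ⊆ A → A'.Nonempty → Arrow A {b} → Arrow A' {b}
  arrow_union : ∀ A₁ A₂ B₁ B₂ : Finset State,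
    A₁ ∈ Eido → A₂ ∈ Eido → B₁ ∈ Eido → B₂ ∈ Eido →
    Disjoint A₁ A₂ → Disjoint B₁ B₂ →
    (∀ a ∈ A₁ ∪ A₂, ∀ b ∈ A₁ ∪ A₂, Arrow {a} {b} ∨ Arrow {b} {a}) →
    (∀ a ∈ B₁ ∪ B₂, ∀ b ∈ B₁ ∪ B₂, Arrow {a} {b} ∨ Arrow {b} {a}) →
    Arrow A₁ B₁ → Arrow A₂ B₂ → Arrow (A₁ ∪ A₂) (B₁ ∪ B₂)

attribute [instance] EidoSys.decEq

namespace EidoSys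

variable (S : EidoSys)

/-- Combination of eidostates: the Cartesian product, realized via the pairing map. -/
def comb (A B : Finset S.State) : Finset S.State := Finset.image₂ S.pair A B

/-- The process (A,B) is possible: A ⇌ B. -/
def Pos (A B : Finset S.State) : Prop := S.Arrow A B ∨ S.Arrow B A

/-- A ↔ B. -/
def Rev (A B : Finset S.State) : Prop := S.Arrow A B ∧ S.Arrow B A

/-- Uniform eidostate. -/
def Uniform (A : Finset S.State) : Prop := A ∈ S.Eido ∧ ∀ a ∈ A, ∀ b ∈ A, S.Pos {a} {b}

/-- Record state: a ↔ a + r for some state a. -/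
def IsRecord (r : S.State) : Prop := ∃ a : S.State, S.Rev {a} (S.comb {a} {r})

/-- Information state: an eidostate all of whose elements are record states. -/
def IsInfo (I : Finset S.State) : Prop := I ∈ S.Eido ∧ ∀ r ∈ I, S.IsRecord r

/-- Bit state: an information state with exactly two elements. -/
def IsBit (I : Finset S.State) : Prop := S.IsInfo I ∧ I.card = 2

/-- Information axiom: there exist a bit state and a possible bit process. -/
def InfoAxiom : Prop := ∃ (r : S.State) (I : Finset S.State), S.IsRecord r ∧ S.IsBit I ∧ S.Pos {r} I

/-- Demon axiom. -/
def DemonAxiom : Prop := ∀ a b : S.State, ∀ J : Finset S.State, S.IsInfo J →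
    S.Arrow {a} (S.comb {b} J) →
    (∃ I : Finset S.State, S.IsInfo I ∧ S.Arrow {b} (S.comb {a} I)) ∧
    (∀ I : Finset S.State, S.IsInfo I → S.Arrow {a} (S.comb {b} I) ∨ S.Arrow (S.comb {b} I) {a})

/-- `copies A n` is the combination of `n+1` copies of `A` (so `copies A 0 = A`). -/
def copies (A : Finset S.State) : ℕ → Finset S.State
  | 0 => A
  | n + 1 => S.comb A (copies A n)

/-- Stability axiom: if nA → nB + J for arbitrarily large n, then A → B. -/
def StabilityAxiom : Prop := ∀ A B J : Finset S.State, A ∈ S.Eido → B ∈ S.Eido → S.IsInfo J →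
    (∀ N : ℕ, ∃ n ≥ N, S.Arrow (S.copies A n) (S.comb (S.copies B n) J)) → S.Arrow A B

/-- State-equivalence axiom. -/
def StateEquivAxiom : Prop := ∀ E : Finset S.State, S.Uniform E →
    ∃ e x y : S.State, S.Arrow {x} {y} ∧ S.Rev (S.comb E {x}) (S.comb {e} {y})

/-- `addCopies A B k` is A + k·B (k copies of B appended to A). -/
def addCopies (A B : Finset S.State) : ℕ → Finset S.State
  | 0 => A
  | k + 1 => S.comb (addCopies A B k) B

/-- A designated set of mechanical states. -/
def MechSet (M : Set S.State) : Prop :=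
  (∀ l ∈ M, ∀ m ∈ M, S.pair l m ∈ M) ∧
  (∀ l ∈ M, ∀ m ∈ M, S.Arrow {l} {m} → S.Arrow {m} {l})

/-- Component of content on uniform eidostates. -/
def IsCoCU (Q : Finset S.State → ℝ) : Prop :=
  (∀ E F : Finset S.State, S.Uniform E → S.Uniform F → Q (S.comb E F) = Q E + Q F) ∧
  (∀ E F : Finset S.State, S.Uniform E → S.Uniform F → S.Pos E F → Q E = Q F)

/-- Entropy function on the uniform eidostates (relative to mechanical states M). -/
def IsEntropyU (M : Set S.State) (Ent : Finset S.State → ℝ) : Prop :=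
  (∀ E F : Finset S.State, S.Uniform E → S.Uniform F → Ent (S.comb E F) = Ent E + Ent F) ∧
  (∀ E F : Finset S.State, S.Uniform E → S.Uniform F → S.Pos E F → (S.Arrow E F ↔ Ent E ≤ Ent F)) ∧
  (∀ m ∈ M, Ent {m} = 0) ∧
  (∀ I : Finset S.State, S.IsInfo I → Ent I = Real.logb 2 (I.card))

end EidoSys

namespace EidoSys

variable {S : EidoSys}

theorem comb_singleton (a b : S.State) : S.comb {a} {b} = {S.pair a b} :=
  Finset.image₂_singleton

theorem comb_mem_eido {A B : Finset S.State} (hA : A ∈ S.Eido) (hB : B ∈ S.Eido) :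
    S.comb A B ∈ S.Eido := (S.comb_mem A B).2 ⟨hA, hB⟩

theorem sim_comb {A B C D : Finset S.State} (h₁ : S.Sim A B) (h₂ : S.Sim C D) :
    S.Sim (S.comb A C) (S.comb B D) :=
  S.sim_trans _ _ _ (S.sim_congr A B C h₁) (S.sim_trans _ _ _ (S.sim_comm B C)
    (S.sim_trans _ _ _ (S.sim_congr C D B h₂) (S.sim_comm D B)))

theorem sim_right_comm (A B C : Finset S.State) :
    S.Sim (S.comb (S.comb A B) C) (S.comb (S.comb A C) B) :=
  S.sim_trans _ _ _ (S.sim_assoc A B C) (S.sim_trans _ _ _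
    (sim_comb (S.sim_refl A) (S.sim_comm B C)) (S.sim_symm _ _ (S.sim_assoc A C B)))

theorem sim_comb_comb_comm (A B C D : Finset S.State) :
    S.Sim (S.comb (S.comb A B) (S.comb C D)) (S.comb (S.comb A C) (S.comb B D)) := by
  refine S.sim_trans _ _ _ (S.sim_symm _ _ (S.sim_assoc (S.comb A B) C D)) ?_
  exact S.sim_trans _ _ _ (sim_comb (sim_right_comm A B C) (S.sim_refl D))
    (S.sim_assoc (S.comb A C) B D)

theorem arrow_refl {A : Finset S.State} (hA : A ∈ S.Eido) : S.Arrow A A :=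
  S.arrow_of_sim A A hA hA (S.sim_refl A)

theorem arrow_comb_left {A B C : Finset S.State} (hA : A ∈ S.Eido) (hB : B ∈ S.Eido)
    (hC : C ∈ S.Eido) (h : S.Arrow A B) : S.Arrow (S.comb C A) (S.comb C B) :=
  S.arrow_trans _ _ _
    (S.arrow_of_sim _ _ (comb_mem_eido hC hA) (comb_mem_eido hA hC) (S.sim_comm C A))
    (S.arrow_trans _ _ _ (S.arrow_comb A B C h)
      (S.arrow_of_sim _ _ (comb_mem_eido hB hC) (comb_mem_eido hC hB) (S.sim_comm B C)))

theorem rev_comb_record (a : S.State) {r : S.State} (hr : S.IsRecord r) :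
    S.Rev {a} (S.comb {a} {r}) := by
  obtain ⟨c, h₁, h₂⟩ := hr
  have ha := S.singleton_mem a
  have hc := S.singleton_mem c
  have hrm := S.singleton_mem r
  have e₁ : S.Sim (S.comb {a} (S.comb {c} {r})) (S.comb (S.comb {a} {r}) {c}) :=
    S.sim_trans _ _ _ (S.sim_symm _ _ (S.sim_assoc {a} {c} {r})) (sim_right_comm {a} {c} {r})
  have m₁ := comb_mem_eido ha (comb_mem_eido hc hrm)
  have m₂ := comb_mem_eido (comb_mem_eido ha hrm) hc
  constructor
  · exact S.arrow_cancel _ _ c (S.arrow_trans _ _ _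
      (arrow_comb_left hc (comb_mem_eido hc hrm) ha h₁) (S.arrow_of_sim _ _ m₁ m₂ e₁))
  · exact S.arrow_cancel _ _ c (S.arrow_trans _ _ _
      (S.arrow_of_sim _ _ m₂ m₁ (S.sim_symm _ _ e₁))
      (arrow_comb_left (comb_mem_eido hc hrm) hc ha h₂))

theorem arrow_record {r s : S.State} (hr : S.IsRecord r) (hs : S.IsRecord s) :
    S.Arrow {r} {s} := by
  have mr := S.singleton_mem r
  have ms := S.singleton_mem s
  refine S.arrow_cancel _ _ r (S.arrow_trans _ _ _ (rev_comb_record r hr).2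
    (S.arrow_trans _ _ _ (rev_comb_record r hs).1 ?_))
  exact S.arrow_of_sim _ _ (comb_mem_eido mr ms) (comb_mem_eido ms mr) (S.sim_comm {r} {s})

theorem IsInfo.uniform {I : Finset S.State} (hI : S.IsInfo I) : S.Uniform I :=
  ⟨hI.1, fun _ ha _ hb => Or.inl (arrow_record (hI.2 _ ha) (hI.2 _ hb))⟩

theorem IsInfo.subset {I J : Finset S.State} (hI : S.IsInfo I) (h : J ⊆ I) (hJ : J.Nonempty) :
    S.IsInfo J :=
  ⟨S.subset_mem I J hI.1 h hJ, fun r hr => hI.2 r (h hr)⟩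

theorem isRecord_pair {r s : S.State} (hr : S.IsRecord r) (hs : S.IsRecord s) :
    S.IsRecord (S.pair r s) := by
  have mr := S.singleton_mem r
  have ms := S.singleton_mem s
  have h₁ := rev_comb_record r hr
  have h₂ := rev_comb_record (S.pair r r) hs
  refine ⟨r, ?_⟩
  rw [← comb_singleton] at h₂ ⊢
  have m₁ := comb_mem_eido (comb_mem_eido mr mr) ms
  have m₂ := comb_mem_eido mr (comb_mem_eido mr ms)
  have e := S.sim_assoc {r} {r} {s}
  exact ⟨S.arrow_trans _ _ _ h₁.1 (S.arrow_trans _ _ _ h₂.1 (S.arrow_of_sim _ _ m₁ m₂ e)),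
    S.arrow_trans _ _ _ (S.arrow_of_sim _ _ m₂ m₁ (S.sim_symm _ _ e))
      (S.arrow_trans _ _ _ h₂.2 h₁.2)⟩

theorem IsInfo.comb {I J : Finset S.State} (hI : S.IsInfo I) (hJ : S.IsInfo J) :
    S.IsInfo (S.comb I J) := by
  refine ⟨comb_mem_eido hI.1 hJ.1, fun r hr => ?_⟩
  obtain ⟨a, ha, b, hb, rfl⟩ := Finset.mem_image₂.1 hr
  exact isRecord_pair (hI.2 a ha) (hJ.2 b hb)

theorem card_comb (A B : Finset S.State) : (S.comb A B).card = A.card * B.card :=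
  Finset.card_image₂_iff.2 fun _ _ _ _ h =>
    Prod.ext (S.pair_inj _ _ _ _ h).1 (S.pair_inj _ _ _ _ h).2

theorem exists_isInfo_card_eq (h : S.InfoAxiom) {n : ℕ} (hn : 0 < n) :
    ∃ I, S.IsInfo I ∧ I.card = n := by
  obtain ⟨-, B, -, ⟨hB, hB2⟩, -⟩ := h
  have key : ∀ k : ℕ, ∃ I, S.IsInfo I ∧ k < I.card := by
    intro k
    induction k with
    | zero => exact ⟨B, hB, by omega⟩
    | succ k ih =>
      obtain ⟨I, hI, hk⟩ := ih
      exact ⟨S.comb B I, hB.comb hI, by rw [card_comb, hB2]; omega⟩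
  obtain ⟨I, hI, hk⟩ := key n
  obtain ⟨J, hJI, hJ⟩ := Finset.exists_subset_card_eq hk.le
  exact ⟨J, hI.subset hJI (Finset.card_pos.1 (by omega)), hJ⟩

theorem uniform_singleton (a : S.State) : S.Uniform {a} := by
  refine ⟨S.singleton_mem a, fun x hx y hy => ?_⟩
  rw [Finset.mem_singleton] at hx hy
  subst hx hy
  exact Or.inl (arrow_refl (S.singleton_mem _))

theorem Uniform.subset {E F : Finset S.State} (hE : S.Uniform E) (h : F ⊆ E) (hF : F.Nonempty) :
    S.Uniform F :=
  ⟨S.subset_mem E F hE.1 h hF, fun a ha b hb => hE.2 a (h ha) b (h hb)⟩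

theorem Uniform.comb_isInfo {E I : Finset S.State} (hE : S.Uniform E) (hI : S.IsInfo I) :
    S.Uniform (S.comb E I) := by
  have key : ∀ {a b r s : S.State}, S.IsRecord r → S.IsRecord s → S.Arrow {a} {b} →
      S.Arrow {S.pair a r} {S.pair b s} := by
    intro a b r s hr hs h
    rw [← comb_singleton, ← comb_singleton]
    exact S.arrow_trans _ _ _ (rev_comb_record a hr).2
      (S.arrow_trans _ _ _ h (rev_comb_record b hs).1)
  refine ⟨comb_mem_eido hE.1 hI.1, fun x hx y hy => ?_⟩
  obtain ⟨a, ha, r, hr, rfl⟩ := Finset.mem_image₂.1 hx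
  obtain ⟨b, hb, s, hs, rfl⟩ := Finset.mem_image₂.1 hy
  exact (hE.2 a ha b hb).imp (key (hI.2 r hr) (hI.2 s hs)) (key (hI.2 s hs) (hI.2 r hr))

/-- If a state `b` can be turned into `a` together with some information state, then
`b + I` and `a + I'` are always comparable. -/
theorem pos_comb_isInfo (hdemon : S.DemonAxiom) (hse : S.StateEquivAxiom) {a b : S.State}
    {I I' J : Finset S.State} (hJ : S.IsInfo J) (hb : S.Arrow {b} (S.comb {a} J))
    (hI : S.IsInfo I) (hI' : S.IsInfo I') : S.Pos (S.comb {b} I) (S.comb {a} I') := by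
  obtain ⟨e, x, y, -, h₁, h₂⟩ := hse I hI.uniform
  have ma := S.singleton_mem a
  have mb := S.singleton_mem b
  have me := S.singleton_mem e
  have mx := S.singleton_mem x
  have my := S.singleton_mem y
  have mIx := comb_mem_eido hI.1 mx
  have mey := comb_mem_eido me my
  have mbI := comb_mem_eido (comb_mem_eido mb hI.1) mx
  have mbIx := comb_mem_eido mb mIx
  have maI := comb_mem_eido (comb_mem_eido ma hI'.1) mx
  have maxI := comb_mem_eido (comb_mem_eido ma mx) hI'.1
  have maJ := comb_mem_eido ma hJ.1
  have p₁ : S.Arrow (S.comb (S.comb {b} I) {x}) (S.comb {b} (S.comb {e} {y})) :=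
    S.arrow_trans _ _ _ (S.arrow_of_sim _ _ mbI mbIx (S.sim_assoc {b} I {x}))
      (arrow_comb_left mIx mey mb h₁)
  have p₂ : S.Arrow (S.comb {b} (S.comb {e} {y})) (S.comb {b} (S.comb I {x})) :=
    arrow_comb_left mey mIx mb h₂
  have p₃ : S.Arrow (S.comb {b} (S.comb {e} {y})) (S.comb (S.comb {b} I) {x}) :=
    S.arrow_trans _ _ _ p₂
      (S.arrow_of_sim _ _ mbIx mbI (S.sim_symm _ _ (S.sim_assoc {b} I {x})))
  have p₄ : S.Arrow (S.comb {b} (S.comb {e} {y})) (S.comb (S.comb {a} {x}) (S.comb J I)) := by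
    refine S.arrow_trans _ _ _ p₂ (S.arrow_trans _ _ _
      (S.arrow_comb {b} (S.comb {a} J) (S.comb I {x}) hb) ?_)
    refine S.arrow_of_sim _ _ (comb_mem_eido maJ mIx)
      (comb_mem_eido (comb_mem_eido ma mx) (comb_mem_eido hJ.1 hI.1)) ?_
    exact S.sim_trans _ _ _ (sim_comb (S.sim_refl _) (S.sim_comm I {x}))
      (sim_comb_comb_comm {a} J {x} I)
  have hd := hdemon (S.pair b (S.pair e y)) (S.pair a x) (S.comb J I) (hJ.comb hI)
  rw [← comb_singleton, ← comb_singleton, ← comb_singleton] at hd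
  refine ((hd p₄).2 I' hI').imp (fun h => ?_) (fun h => ?_)
  · exact S.arrow_cancel _ _ x (S.arrow_trans _ _ _ p₁ (S.arrow_trans _ _ _ h
      (S.arrow_of_sim _ _ maxI maI (sim_right_comm {a} {x} I'))))
  · exact S.arrow_cancel _ _ x (S.arrow_trans _ _ _
      (S.arrow_of_sim _ _ maI maxI (sim_right_comm {a} I' {x})) (S.arrow_trans _ _ _ h p₃))

theorem pos_comb_of_arrow (hinfo : S.InfoAxiom) (hdemon : S.DemonAxiom)
    (hse : S.StateEquivAxiom) {a b : S.State} (hab : S.Arrow {a} {b})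
    {I I' : Finset S.State} (hI : S.IsInfo I) (hI' : S.IsInfo I') :
    S.Pos (S.comb {b} I) (S.comb {a} I') := by
  obtain ⟨J, hJ, hJc⟩ := exists_isInfo_card_eq hinfo one_pos
  obtain ⟨r, rfl⟩ := Finset.card_eq_one.1 hJc
  have hr : S.IsRecord r := hJ.2 r (Finset.mem_singleton_self r)
  obtain ⟨K, hK, h⟩ :=
    (hdemon a b {r} hJ (S.arrow_trans _ _ _ hab (rev_comb_record b hr).1)).1
  exact pos_comb_isInfo hdemon hse hK h hI hI'

theorem disjoint_comb_left {A B : Finset S.State} (h : Disjoint A B) (C D : Finset S.State) :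
    Disjoint (S.comb A C) (S.comb B D) := by
  rw [Finset.disjoint_left]
  intro x hx hy
  obtain ⟨a, ha, c, -, rfl⟩ := Finset.mem_image₂.1 hx
  obtain ⟨b, hb, d, -, e⟩ := Finset.mem_image₂.1 hy
  exact Finset.disjoint_left.1 h ha ((S.pair_inj _ _ _ _ e).1 ▸ hb)

theorem disjoint_comb_right {A B : Finset S.State} (h : Disjoint A B) (C D : Finset S.State) :
    Disjoint (S.comb C A) (S.comb D B) := by
  rw [Finset.disjoint_left]
  intro x hx hy
  obtain ⟨c, -, a, ha, rfl⟩ := Finset.mem_image₂.1 hx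
  obtain ⟨d, -, b, hb, e⟩ := Finset.mem_image₂.1 hy
  exact Finset.disjoint_left.1 h ha ((S.pair_inj _ _ _ _ e).2 ▸ hb)

/-- A relation compatible with disjoint unions of uniform eidostates holds between `F + I` and
`a + K` as soon as it holds between each `e + I` and `a + J` with `J` of prescribed size. -/
theorem rel_comb_of_forall_mem {R : Finset S.State → Finset S.State → Prop}
    (hR : ∀ A₁ A₂ B₁ B₂ : Finset S.State, A₁ ∈ S.Eido → A₂ ∈ S.Eido → B₁ ∈ S.Eido →
      B₂ ∈ S.Eido → Disjoint A₁ A₂ → Disjoint B₁ B₂ → S.Uniform (A₁ ∪ A₂) →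
      S.Uniform (B₁ ∪ B₂) → R A₁ B₁ → R A₂ B₂ → R (A₁ ∪ A₂) (B₁ ∪ B₂))
    {E I : Finset S.State} (hE : S.Uniform E) (hI : S.IsInfo I) (a : S.State)
    {q : S.State → ℕ} (hq : ∀ e ∈ E, 0 < q e)
    (h : ∀ e ∈ E, ∀ J, S.IsInfo J → J.card = q e → R (S.comb {e} I) (S.comb {a} J))
    {K : Finset S.State} (hK : S.IsInfo K) (hKc : K.card = ∑ e ∈ E, q e) :
    R (S.comb E I) (S.comb {a} K) := by
  have hne := S.eido_nonempty E hE.1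
  induction hne using Finset.Nonempty.cons_induction generalizing K with
  | singleton e => exact h e (Finset.mem_singleton_self e) K hK (by simpa using hKc)
  | cons e F he hF ih =>
    rw [Finset.sum_cons] at hKc
    obtain ⟨K₁, hK₁, hc₁⟩ := Finset.exists_subset_card_eq (s := K) (n := q e) (by omega)
    have hsub : F ⊆ Finset.cons e F he := Finset.subset_cons he
    have hUF := hE.subset hsub hF
    have hc₂ : (K \ K₁).card = ∑ x ∈ F, q x := by
      rw [Finset.card_sdiff_of_subset hK₁]; omega
    have hpos : 0 < ∑ x ∈ F, q x := Finset.sum_pos (fun x hx => hq x (hsub hx)) hF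
    have hI₁ : S.IsInfo K₁ := hK.subset hK₁
      (Finset.card_pos.1 (hc₁ ▸ hq e (Finset.mem_cons_self e F)))
    have hI₂ : S.IsInfo (K \ K₁) := hK.subset Finset.sdiff_subset
      (Finset.card_pos.1 (hc₂ ▸ hpos))
    have r₁ := h e (Finset.mem_cons_self e F) K₁ hI₁ hc₁
    have r₂ := ih hUF (fun x hx => hq x (hsub hx)) (fun x hx => h x (hsub hx)) hI₂ hc₂
    have eE : S.comb (Finset.cons e F he) I = S.comb {e} I ∪ S.comb F I := by
      rw [Finset.cons_eq_insert, Finset.insert_eq]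
      exact Finset.image₂_union_left
    have eK : S.comb {a} K = S.comb {a} K₁ ∪ S.comb {a} (K \ K₁) := by
      conv_lhs => rw [← Finset.union_sdiff_of_subset hK₁]
      exact Finset.image₂_union_right
    have uE := hE.comb_isInfo hI
    have uK := (uniform_singleton a).comb_isInfo hK
    rw [eE] at uE ⊢
    rw [eK] at uK ⊢
    exact hR _ _ _ _ (comb_mem_eido (S.singleton_mem e) hI.1) (comb_mem_eido hUF.1 hI.1)
      (comb_mem_eido (S.singleton_mem a) hI₁.1) (comb_mem_eido (S.singleton_mem a) hI₂.1)
      (disjoint_comb_left (Finset.disjoint_singleton_left.2 he) _ _)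
      (disjoint_comb_right Finset.disjoint_sdiff _ _) uE uK r₁ r₂

theorem IsEntropyU.two_rpow_comb {M : Set S.State} {Ent : Finset S.State → ℝ}
    (hEnt : S.IsEntropyU M Ent) {E I : Finset S.State} (hE : S.Uniform E) (hI : S.IsInfo I) :
    (2 : ℝ) ^ Ent (S.comb E I) = (2 : ℝ) ^ Ent E * I.card := by
  have hc : (0 : ℝ) < I.card := by exact_mod_cast Finset.card_pos.2 (S.eido_nonempty I hI.1)
  rw [hEnt.1 E I hE hI.uniform, hEnt.2.2.2 I hI, Real.rpow_add two_pos,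
    Real.rpow_logb two_pos (by norm_num) hc]

theorem IsEntropyU.arrow_iff {M : Set S.State} {Ent : Finset S.State → ℝ}
    (hEnt : S.IsEntropyU M Ent) {E F : Finset S.State} (hE : S.Uniform E) (hF : S.Uniform F)
    (h : S.Pos E F) : S.Arrow E F ↔ (2 : ℝ) ^ Ent E ≤ (2 : ℝ) ^ Ent F := by
  rw [hEnt.2.1 E F hE hF h, Real.rpow_le_rpow_left_iff one_lt_two]

theorem eq_of_forall_nat_mul_abs_sub_le {x y C : ℝ}
    (h : ∀ N : ℕ, 0 < N → N * |x - y| ≤ C) : x = y := by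
  by_contra hne
  have hpos : 0 < |x - y| := abs_pos.2 (sub_ne_zero.2 hne)
  obtain ⟨N, hN⟩ := exists_nat_gt (C / |x - y|)
  rw [div_lt_iff₀ hpos] at hN
  have := h (N + 1) N.succ_pos
  push_cast at this
  nlinarith

/-- The entropy of a uniform eidostate is determined by the entropies of its states. -/
theorem IsEntropyU.sum_two_rpow {M : Set S.State} {Ent : Finset S.State → ℝ}
    (hEnt : S.IsEntropyU M Ent) (hinfo : S.InfoAxiom) (hdemon : S.DemonAxiom)
    (hse : S.StateEquivAxiom) {E : Finset S.State} (hE : S.Uniform E) :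
    ∑ e ∈ E, (2 : ℝ) ^ Ent {e} = (2 : ℝ) ^ Ent E := by
  obtain ⟨a, ha, hmin⟩ := Finset.exists_min_image E (fun e => Ent {e}) (S.eido_nonempty E hE.1)
  set w : ℝ := (2 : ℝ) ^ Ent {a}
  have hw0 : 0 < w := Real.rpow_pos_of_pos two_pos _
  have hwe : ∀ e ∈ E, w ≤ (2 : ℝ) ^ Ent {e} := fun e he =>
    Real.rpow_le_rpow_of_exponent_le one_le_two (hmin e he)
  have harr : ∀ e ∈ E, S.Arrow {a} {e} := fun e he =>
    (hEnt.2.1 _ _ (uniform_singleton a) (uniform_singleton e) (hE.2 a ha e he)).2 (hmin e he)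
  apply eq_of_forall_nat_mul_abs_sub_le (C := E.card * w)
  intro N hN
  have hN0 : (0 : ℝ) < N := by exact_mod_cast hN
  obtain ⟨I, hI, hIc⟩ := exists_isInfo_card_eq hinfo hN
  have hpos : ∀ e ∈ E, ∀ J, S.IsInfo J → S.Pos (S.comb {e} I) (S.comb {a} J) :=
    fun e he J hJ => pos_comb_of_arrow hinfo hdemon hse (harr e he) hI hJ
  have hu : ∀ e, S.Uniform (S.comb {e} I) := fun e => (uniform_singleton e).comb_isInfo hI
  have hone : ∀ e ∈ E, 1 ≤ N * (2 : ℝ) ^ Ent {e} / w := fun e he => by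
    rw [le_div_iff₀ hw0]
    have : (1 : ℝ) ≤ N := by exact_mod_cast hN
    nlinarith [hwe e he]
  have hne := S.eido_nonempty E hE.1
  have upper : (2 : ℝ) ^ Ent E * N ≤ w * ∑ e ∈ E, (⌈N * (2 : ℝ) ^ Ent {e} / w⌉₊ : ℝ) := by
    have hq : ∀ e ∈ E, 0 < ⌈N * (2 : ℝ) ^ Ent {e} / w⌉₊ := fun e he =>
      Nat.ceil_pos.2 (lt_of_lt_of_le one_pos (hone e he))
    obtain ⟨K, hK, hKc⟩ := exists_isInfo_card_eq hinfo (Finset.sum_pos hq hne)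
    have h := rel_comb_of_forall_mem (R := S.Arrow)
      (fun A₁ A₂ B₁ B₂ m₁ m₂ m₃ m₄ d₁ d₂ u₁ u₂ =>
        S.arrow_union A₁ A₂ B₁ B₂ m₁ m₂ m₃ m₄ d₁ d₂ u₁.2 u₂.2) hE hI a hq
      (fun e he J hJ hJc => by
        have uJ := (uniform_singleton a).comb_isInfo hJ
        rw [hEnt.arrow_iff (hu e) uJ (hpos e he J hJ), hEnt.two_rpow_comb (uniform_singleton e) hI,
          hEnt.two_rpow_comb (uniform_singleton a) hJ, hIc, hJc, mul_comm, ← div_le_iff₀' hw0]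
        exact Nat.le_ceil _) hK hKc
    rw [hEnt.arrow_iff (hE.comb_isInfo hI) ((uniform_singleton a).comb_isInfo hK) (Or.inl h),
      hEnt.two_rpow_comb hE hI, hEnt.two_rpow_comb (uniform_singleton a) hK, hIc, hKc] at h
    exact_mod_cast h
  have lower : w * ∑ e ∈ E, (⌊N * (2 : ℝ) ^ Ent {e} / w⌋₊ : ℝ) ≤ (2 : ℝ) ^ Ent E * N := by
    have hq : ∀ e ∈ E, 0 < ⌊N * (2 : ℝ) ^ Ent {e} / w⌋₊ := fun e he =>
      Nat.floor_pos.2 (hone e he)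
    obtain ⟨K, hK, hKc⟩ := exists_isInfo_card_eq hinfo (Finset.sum_pos hq hne)
    have h := rel_comb_of_forall_mem (R := fun A B => S.Arrow B A)
      (fun A₁ A₂ B₁ B₂ m₁ m₂ m₃ m₄ d₁ d₂ u₁ u₂ =>
        S.arrow_union B₁ B₂ A₁ A₂ m₃ m₄ m₁ m₂ d₂ d₁ u₂.2 u₁.2) hE hI a hq
      (fun e he J hJ hJc => by
        have uJ := (uniform_singleton a).comb_isInfo hJ
        rw [hEnt.arrow_iff uJ (hu e) (hpos e he J hJ).symm,
          hEnt.two_rpow_comb (uniform_singleton e) hI,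
          hEnt.two_rpow_comb (uniform_singleton a) hJ, hIc, hJc, mul_comm _ (N : ℝ),
          ← le_div_iff₀' hw0]
        exact Nat.floor_le (zero_le_one.trans (hone e he))) hK hKc
    rw [hEnt.arrow_iff ((uniform_singleton a).comb_isInfo hK) (hE.comb_isInfo hI) (Or.inl h),
      hEnt.two_rpow_comb hE hI, hEnt.two_rpow_comb (uniform_singleton a) hK, hIc, hKc] at h
    exact_mod_cast h
  have hceil : w * ∑ e ∈ E, (⌈N * (2 : ℝ) ^ Ent {e} / w⌉₊ : ℝ) ≤
      N * ∑ e ∈ E, (2 : ℝ) ^ Ent {e} + E.card * w := by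
    rw [Finset.mul_sum, Finset.mul_sum, ← nsmul_eq_mul, ← Finset.sum_const,
      ← Finset.sum_add_distrib]
    refine Finset.sum_le_sum fun e he => ?_
    have := (Nat.ceil_lt_add_one (zero_le_one.trans (hone e he))).le
    calc _ ≤ w * (N * (2 : ℝ) ^ Ent {e} / w + 1) := by gcongr
      _ = _ := by field_simp
  have hfloor : N * ∑ e ∈ E, (2 : ℝ) ^ Ent {e} ≤
      w * ∑ e ∈ E, (⌊N * (2 : ℝ) ^ Ent {e} / w⌋₊ : ℝ) + E.card * w := by
    rw [Finset.mul_sum, Finset.mul_sum, ← nsmul_eq_mul, ← Finset.sum_const,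
      ← Finset.sum_add_distrib]
    refine Finset.sum_le_sum fun e he => ?_
    have := (Nat.lt_floor_add_one (N * (2 : ℝ) ^ Ent {e} / w)).le
    rw [div_le_iff₀ hw0] at this
    linarith
  rw [← abs_of_pos hN0, ← abs_mul, abs_le]
  constructor <;> nlinarith

theorem IsEntropyU.mean_add_shannon {M : Set S.State} {Ent : Finset S.State → ℝ}
    (hEnt : S.IsEntropyU M Ent) (hinfo : S.InfoAxiom) (hdemon : S.DemonAxiom)
    (hse : S.StateEquivAxiom) {E : Finset S.State} (hE : S.Uniform E) :
    (∑ a ∈ E, (2 : ℝ) ^ (Ent {a} - Ent E) * Ent {a}) -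
      ∑ a ∈ E, (2 : ℝ) ^ (Ent {a} - Ent E) *
        Real.logb 2 ((2 : ℝ) ^ (Ent {a} - Ent E)) = Ent E := by
  have hsum : ∑ a ∈ E, (2 : ℝ) ^ (Ent {a} - Ent E) = 1 := by
    simp_rw [Real.rpow_sub two_pos]
    rw [← Finset.sum_div, hEnt.sum_two_rpow hinfo hdemon hse hE,
      div_self (Real.rpow_pos_of_pos two_pos _).ne']
  rw [← Finset.sum_sub_distrib]
  conv_rhs => rw [← one_mul (Ent E), ← hsum, Finset.sum_mul]
  refine Finset.sum_congr rfl fun a _ => ?_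
  rw [Real.logb_rpow two_pos (by norm_num)]
  ring

end EidoSys

/-- Generalized Landauer bound: if A → B for uniform eidostates A, B, then
⟨𝕊⟩_B − ⟨𝕊⟩_A ≥ −(H_B − H_A), where ⟨𝕊⟩_E = Σ_{a∈E} P(a|E)·𝕊(a) and
H_E = −Σ_{a∈E} P(a|E)·log₂ P(a|E) with P(a|E) = 2^{𝕊(a) − 𝕊(E)}. -/
theorem stmt19 (S : EidoSys) (hinfo : S.InfoAxiom) (hdemon : S.DemonAxiom)
    (hstab : S.StabilityAxiom) (hse : S.StateEquivAxiom)
    (M : Set S.State) (hM : S.MechSet M)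
    (Ent : Finset S.State → ℝ) (hEnt : S.IsEntropyU M Ent)
    (A B : Finset S.State) (hA : S.Uniform A) (hB : S.Uniform B) (hAB : S.Arrow A B) :
    (∑ a ∈ B, (2 : ℝ) ^ (Ent {a} - Ent B) * Ent {a}) -
      (∑ a ∈ A, (2 : ℝ) ^ (Ent {a} - Ent A) * Ent {a}) ≥
    -((- ∑ a ∈ B, (2 : ℝ) ^ (Ent {a} - Ent B) *
          Real.logb 2 ((2 : ℝ) ^ (Ent {a} - Ent B))) -
      (- ∑ a ∈ A, (2 : ℝ) ^ (Ent {a} - Ent A) *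
          Real.logb 2 ((2 : ℝ) ^ (Ent {a} - Ent A)))) := by
  have h₁ := hEnt.mean_add_shannon hinfo hdemon hse hA
  have h₂ := hEnt.mean_add_shannon hinfo hdemon hse hB
  have h₃ := (hEnt.2.1 A B hA hB (Or.inl hAB)).1 hAB
  linarith
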